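/- arXiv:2605.24796 — 7 statements merged into one kernel-verified Lean document; each statement's English description precedes it below -/
import Mathlib

section
/- Let (M, ⊥_M) and (N, ⊥_N) be phase spaces and let f : M → N be any function. The following four conditions are equivalent: (1) for all A ⊆ M, (f(A))^{⊥⊥} = (f(A^{⊥⊥}))^{⊥⊥}; (2) for all A ⊆ M, f(A^{⊥⊥}) ⊆ (f(A))^{⊥⊥}; (3) for all y ∈ N, (f⁻¹(y^⊥))^{⊥⊥} ⊆ f⁻¹(y^⊥); (4) for all A, B ⊆ M, A^⊥ ⊆ B^⊥ implies (f(A))^⊥ ⊆ (f(B))^⊥. -/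
/-- The dual of a subset of a phase space: `A^⊥ = {x | ∀ a ∈ A, x + a ∈ bot}`. -/
def phaseDual {M : Type*} [AddCommMonoid M] (bot : Set M) (A : Set M) : Set M :=
  {x | ∀ a ∈ A, x + a ∈ bot}

theorem subset_phaseDual_comm {M : Type*} [AddCommMonoid M] {bot A B : Set M} :
    A ⊆ phaseDual bot B ↔ B ⊆ phaseDual bot A :=
  ⟨fun h b hb a ha => add_comm a b ▸ h ha b hb, fun h a ha b hb => add_comm b a ▸ h hb a ha⟩

theorem phaseDual_anti {M : Type*} [AddCommMonoid M] {bot A B : Set M} (h : A ⊆ B) :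
    phaseDual bot B ⊆ phaseDual bot A :=
  fun _ hx a ha => hx a (h ha)

theorem subset_phaseDual_phaseDual {M : Type*} [AddCommMonoid M] (bot A : Set M) :
    A ⊆ phaseDual bot (phaseDual bot A) :=
  subset_phaseDual_comm.1 subset_rfl

theorem phaseDual_phaseDual_phaseDual {M : Type*} [AddCommMonoid M] (bot A : Set M) :
    phaseDual bot (phaseDual bot (phaseDual bot A)) = phaseDual bot A :=
  (phaseDual_anti (subset_phaseDual_phaseDual bot A)).antisymm
    (subset_phaseDual_phaseDual bot _)

theorem mem_phaseDual_image_iff {M N : Type*} [AddCommMonoid N] {bot : Set N} {f : M → N}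
    {A : Set M} {y : N} : y ∈ phaseDual bot (f '' A) ↔ A ⊆ f ⁻¹' phaseDual bot {y} := by
  rw [← Set.singleton_subset_iff, subset_phaseDual_comm, Set.image_subset_iff]

/-- The four characterizations of continuity of a function between phase spaces
are equivalent. -/
theorem continuity_tfae {M N : Type*} [AddCommMonoid M] [AddCommMonoid N]
    (botM : Set M) (botN : Set N) (f : M → N) :
    [ -- (1) (f(A))^{⊥⊥} = (f(A^{⊥⊥}))^{⊥⊥}
      (∀ A : Set M,
        phaseDual botN (phaseDual botN (f '' A)) =
          phaseDual botN (phaseDual botN (f '' phaseDual botM (phaseDual botM A)))),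
      -- (2) f(A^{⊥⊥}) ⊆ (f(A))^{⊥⊥}
      (∀ A : Set M,
        f '' phaseDual botM (phaseDual botM A) ⊆ phaseDual botN (phaseDual botN (f '' A))),
      -- (3) (f⁻¹(y^⊥))^{⊥⊥} ⊆ f⁻¹(y^⊥)
      (∀ y : N,
        phaseDual botM (phaseDual botM (f ⁻¹' phaseDual botN {y})) ⊆
          f ⁻¹' phaseDual botN {y}),
      -- (4) A^⊥ ⊆ B^⊥ → (f(A))^⊥ ⊆ (f(B))^⊥
      (∀ A B : Set M, phaseDual botM A ⊆ phaseDual botM B →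
        phaseDual botN (f '' A) ⊆ phaseDual botN (f '' B)) ].TFAE := by
  tfae_have 1 → 2 := fun h A => by
    rw [h A]
    exact subset_phaseDual_phaseDual botN _
  tfae_have 2 → 3 := fun h y => by
    rw [← Set.image_subset_iff]
    exact ((h _).trans (phaseDual_anti (phaseDual_anti (Set.image_preimage_subset f _)))).trans_eq
      (phaseDual_phaseDual_phaseDual botN {y})
  tfae_have 3 → 4 := fun h A B hAB y hy => by
    rw [mem_phaseDual_image_iff] at hy ⊢
    calc
      B ⊆ phaseDual botM (phaseDual botM B) := subset_phaseDual_phaseDual botM B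
      _ ⊆ phaseDual botM (phaseDual botM A) := phaseDual_anti hAB
      _ ⊆ _ := phaseDual_anti (phaseDual_anti hy)
      _ ⊆ f ⁻¹' phaseDual botN {y} := h y
  tfae_have 4 → 1 := fun h A => by
    have hA := phaseDual_phaseDual_phaseDual botM A
    exact congrArg (phaseDual botN) ((h _ _ hA.ge).antisymm (h _ _ hA.le))
  tfae_finish
end

section
/- Let (N, ⊥_N) be a phase space, let M be an additive commutative monoid, let f : M → N be a surjective additive monoid homomorphism, and set ⊥_M := f⁻¹(⊥_N), making (M, ⊥_M) a phase space. Then: (a) f(⊥_M) ⊆ ⊥_N and f is continuous; (b) for every phase space (P, ⊥_P) and every additive monoid homomorphism w : P → M, if the composite f ∘ w satisfies (f ∘ w)(⊥_P) ⊆ ⊥_N and is continuous, then w satisfies w(⊥_P) ⊆ ⊥_M and is continuous. (This is the cartesian-lift property of the forgetful functor from phase spaces to commutative monoids over surjections.) -/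
/-- Continuity of a function between phase spaces. -/
def PhaseCont {M N : Type*} [AddCommMonoid M] [AddCommMonoid N]
    (botM : Set M) (botN : Set N) (f : M → N) : Prop :=
  ∀ A B : Set M, phaseDual botM A ⊆ phaseDual botM B →
    phaseDual botN (f '' A) ⊆ phaseDual botN (f '' B)

theorem mem_phaseDual_preimage_iff {M N : Type*} [AddCommMonoid M] [AddCommMonoid N]
    (bot : Set N) (f : M →+ N) (A : Set M) (x : M) :
    x ∈ phaseDual (f ⁻¹' bot) A ↔ f x ∈ phaseDual bot (f '' A) := by
  simp [phaseDual]

/-- The cartesian-lift property of the forgetful functor from phase spaces to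
commutative monoids over surjections: pulling back the incompatibility set along a
surjective monoid homomorphism yields a phase-space morphism that is cartesian. -/
theorem phase_cartesian_lift {M N : Type*} [AddCommMonoid M] [AddCommMonoid N]
    (botN : Set N) (f : M →+ N) (hf : Function.Surjective f) :
    -- (a) `f` preserves ⊥ and is continuous, where `botM := f ⁻¹' botN`
    (f '' (f ⁻¹' botN) ⊆ botN) ∧
    PhaseCont (f ⁻¹' botN) botN f ∧
    -- (b) the universal property
    (∀ (P : Type*) [AddCommMonoid P] (botP : Set P) (w : P →+ M),
      ((f.comp w) '' botP ⊆ botN) →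
      PhaseCont botP botN (f.comp w) →
      (w '' botP ⊆ f ⁻¹' botN) ∧ PhaseCont botP (f ⁻¹' botN) w) := by
  refine ⟨Set.image_preimage_subset f botN, fun A B hAB y hy => ?_,
    fun P _ botP w hbot hcont => ⟨?_, fun A B hAB x hx => ?_⟩⟩
  · obtain ⟨x, rfl⟩ := hf y
    rw [← mem_phaseDual_preimage_iff] at hy ⊢
    exact hAB hy
  · rintro _ ⟨p, hp, rfl⟩
    exact hbot ⟨p, hp, rfl⟩
  · have h := hcont A B hAB
    rw [AddMonoidHom.coe_comp, Set.image_comp, Set.image_comp] at h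
    rw [mem_phaseDual_preimage_iff] at hx ⊢
    exact h hx
end

section
/- Let F : A ⥤ C be a functor with right adjoint U (unit η, counit ε), and let G : B ⥤ C be a functor such that for every object c of C in the image of G, the counit morphism ε_{G(b)} : F(U(G(b))) → G(b) admits a cartesian lift along G; that is, for each object b of B there is an object b̄ of B with G(b̄) = F(U(G(b))) and a morphism φ_b : b̄ → b with G(φ_b) = ε_{G(b)}, such that for every morphism g : b' → b in B and every morphism w : G(b') → F(U(G(b))) in C with w ≫ ε_{G(b)} = G(g), there is a unique morphism ḡ : b' → b̄ with G(ḡ) = w and ḡ ≫ φ_b = g. Then the projection functor π_B : A ×_C B ⥤ B from the strict pullback category has a right adjoint R, given on objects by R(b) = (U(G(b)), b̄). -/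
open CategoryTheory

universe v₁ v₂ v₃ u₁ u₂ u₃

variable {A : Type u₁} [Category.{v₁} A] {B : Type u₂} [Category.{v₂} B]
  {C : Type u₃} [Category.{v₃} C]

/-- An object of the strict pullback category `A ×_C B` of `F : A ⥤ C` and
`G : B ⥤ C`: a pair of objects whose images in `C` are equal. -/
structure StrictPullback (F : A ⥤ C) (G : B ⥤ C) where
  a : A
  b : B
  eq : F.obj a = G.obj b

/-- A morphism of the strict pullback category: a pair of morphisms whose images
in `C` agree (modulo the object equalities). -/
@[ext]
structure StrictPullbackHom {F : A ⥤ C} {G : B ⥤ C} (x y : StrictPullback F G) where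
  u : x.a ⟶ y.a
  v : x.b ⟶ y.b
  w : F.map u ≫ eqToHom y.eq = eqToHom x.eq ≫ G.map v

instance (F : A ⥤ C) (G : B ⥤ C) : Category (StrictPullback F G) where
  Hom := StrictPullbackHom
  id x := ⟨𝟙 x.a, 𝟙 x.b, by simp⟩
  comp f g := ⟨f.u ≫ g.u, f.v ≫ g.v, by
    rw [Functor.map_comp, Functor.map_comp, Category.assoc, g.w, ← Category.assoc,
      f.w, Category.assoc]⟩
  id_comp f := by apply StrictPullbackHom.ext <;> simp
  comp_id f := by apply StrictPullbackHom.ext <;> simp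
  assoc f g h := by apply StrictPullbackHom.ext <;> simp

/-- The second projection `π_B : A ×_C B ⥤ B`. -/
def strictPullbackSnd (F : A ⥤ C) (G : B ⥤ C) : StrictPullback F G ⥤ B where
  obj x := x.b
  map f := f.v

/-- If `φ : b' ⟶ b` lies over the counit at `G.obj b` and is cartesian, then a morphism from `x`
to the object `(U(G(b)), b')` of the strict pullback is the same as a morphism `x.b ⟶ b`. -/
theorem StrictPullback.bijective_comp_of_cartesian
    {F : A ⥤ C} {G : B ⥤ C} {U : C ⥤ A} (adj : F ⊣ U) {b b' : B}
    (eqb : G.obj b' = F.obj (U.obj (G.obj b))) (φ : b' ⟶ b)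
    (hφ : G.map φ = eqToHom eqb ≫ adj.counit.app (G.obj b))
    (cart : ∀ (b₀ : B) (g : b₀ ⟶ b) (w : G.obj b₀ ⟶ F.obj (U.obj (G.obj b))),
      w ≫ adj.counit.app (G.obj b) = G.map g →
      ∃! gbar : b₀ ⟶ b', G.map gbar = w ≫ eqToHom eqb.symm ∧ gbar ≫ φ = g)
    (x : StrictPullback F G) :
    Function.Bijective
      (fun h : x ⟶ (⟨U.obj (G.obj b), b', eqb.symm⟩ : StrictPullback F G) => h.v ≫ φ) := by
  have counit_eq (h : x ⟶ (⟨U.obj (G.obj b), b', eqb.symm⟩ : StrictPullback F G)) :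
      F.map h.u ≫ adj.counit.app (G.obj b) = eqToHom x.eq ≫ G.map (h.v ≫ φ) := by
    rw [G.map_comp, hφ, ← Category.assoc, ← h.w]
    simp
  have map_v (h : x ⟶ (⟨U.obj (G.obj b), b', eqb.symm⟩ : StrictPullback F G)) :
      G.map h.v = (eqToHom x.eq.symm ≫ F.map h.u) ≫ eqToHom eqb.symm := by
    rw [Category.assoc, h.w]
    simp
  constructor
  · intro h k hk
    change h.v ≫ φ = k.v ≫ φ at hk
    have hu : h.u = k.u := by
      apply (adj.homEquiv _ _).symm.injective
      rw [adj.homEquiv_counit, adj.homEquiv_counit, counit_eq, counit_eq, hk]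
    have hv : h.v = k.v := by
      refine (cart x.b (k.v ≫ φ) (eqToHom x.eq.symm ≫ F.map k.u) ?_).unique
        ⟨?_, hk⟩ ⟨map_v k, rfl⟩
      · rw [Category.assoc, counit_eq]
        simp
      · rw [map_v, hu]
    exact StrictPullbackHom.ext hu hv
  · intro g
    let u : x.a ⟶ U.obj (G.obj b) := adj.homEquiv _ _ (eqToHom x.eq ≫ G.map g)
    have hu : F.map u ≫ adj.counit.app (G.obj b) = eqToHom x.eq ≫ G.map g :=
      (adj.homEquiv_counit _ _ u).symm.trans (Equiv.symm_apply_apply _ _)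
    obtain ⟨v, ⟨hv, hvφ⟩, -⟩ := cart x.b g (eqToHom x.eq.symm ≫ F.map u) (by
      rw [Category.assoc, hu]
      simp)
    exact ⟨⟨u, v, by simp [hv]⟩, hvφ⟩

/-- If `F ⊣ U` and the counit morphisms `ε_{G(b)} : F(U(G(b))) → G(b)` admit
cartesian lifts along `G`, then the projection `π_B : A ×_C B ⥤ B` has a right
adjoint `R` given on objects by `R(b) = (U(G(b)), b̄)`, where `φ_b : b̄ → b` is the
cartesian lift of `ε_{G(b)}`. -/
theorem strictPullback_snd_has_right_adjoint
    (F : A ⥤ C) (G : B ⥤ C) (U : C ⥤ A) (adj : F ⊣ U)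
    (bbar : B → B)
    (eqb : ∀ b : B, G.obj (bbar b) = F.obj (U.obj (G.obj b)))
    (φ : ∀ b : B, bbar b ⟶ b)
    (hφ : ∀ b : B, G.map (φ b) = eqToHom (eqb b) ≫ adj.counit.app (G.obj b))
    (cart : ∀ (b b' : B) (g : b' ⟶ b) (w : G.obj b' ⟶ F.obj (U.obj (G.obj b))),
      w ≫ adj.counit.app (G.obj b) = G.map g →
      ∃! gbar : b' ⟶ bbar b,
        G.map gbar = w ≫ eqToHom (eqb b).symm ∧ gbar ≫ φ b = g) :
    ∃ R : B ⥤ StrictPullback F G,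
      (∀ b : B, R.obj b = ⟨U.obj (G.obj b), bbar b, (eqb b).symm⟩) ∧
      Nonempty (strictPullbackSnd F G ⊣ R) := by
  let e (x : StrictPullback F G) (b : B) :
      ((strictPullbackSnd F G).obj x ⟶ b) ≃
        (x ⟶ (⟨U.obj (G.obj b), bbar b, (eqb b).symm⟩ : StrictPullback F G)) :=
    (Equiv.ofBijective _ (StrictPullback.bijective_comp_of_cartesian adj (eqb b) (φ b) (hφ b)
      (cart b) x)).symm
  have he (x' x : StrictPullback F G) (b : B) (f : x' ⟶ x)
      (g : (strictPullbackSnd F G).obj x ⟶ b) :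
      e x' b ((strictPullbackSnd F G).map f ≫ g) = f ≫ e x b g := by
    rw [← Equiv.eq_symm_apply]
    conv_lhs => rw [← (e x b).symm_apply_apply g]
    exact (Category.assoc f.v (e x b g).v (φ b)).symm
  exact ⟨Adjunction.rightAdjointOfEquiv e he, fun _ => rfl,
    ⟨Adjunction.adjunctionOfEquivRight e he⟩⟩
end

section
/- Let X be a type and ⊥ a set of multisets over X. For Γ ∈ Multiset X define Γ^⊥ := {Θ ∈ Multiset X | Θ + Γ ∈ ⊥}, and define Θ ≤ Γ := Γ^⊥ ⊆ Θ^⊥. Then for every finite family γ₁, …, γₙ of elements of X, the multiset {γ₁, …, γₙ} is in ⊥ if and only if for all multisets Θ₁, …, Θₙ with Θᵢ ≤ {γᵢ} for each i, the sum Θ₁ + ⋯ + Θₙ is in ⊥. (Conservativity of the unit of the free Girard quantale adjunction on unsigned incompatibility frames: the atomic sequents valid in the logically elaborated frame are precisely those of the original frame.) -/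
/-- The dual of a multiset in an unsigned incompatibility frame:
`Γ^⊥ = {Θ | Θ + Γ ∈ bot}`. -/
def msDual {X : Type*} (bot : Set (Multiset X)) (Γ : Multiset X) : Set (Multiset X) :=
  {Θ | Θ + Γ ∈ bot}

/-- Multiset union is monotone for the preorder `Θ ≤ Γ := Γ^⊥ ⊆ Θ^⊥`. -/
theorem msDual_add_subset {X : Type*} {bot : Set (Multiset X)} {Γ Γ' Θ Θ' : Multiset X}
    (h : msDual bot Γ ⊆ msDual bot Θ) (h' : msDual bot Γ' ⊆ msDual bot Θ') :
    msDual bot (Γ + Γ') ⊆ msDual bot (Θ + Θ') := by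
  intro Δ hΔ
  have h₁ : Δ + Γ' ∈ msDual bot Θ := h (by
    simpa only [msDual, Set.mem_ofPred_eq, add_assoc, add_comm Γ'] using hΔ)
  have h₂ : Δ + Θ ∈ msDual bot Θ' := h' (by
    simpa only [msDual, Set.mem_ofPred_eq, add_assoc, add_comm Γ'] using h₁)
  simpa only [msDual, Set.mem_ofPred_eq, add_assoc] using h₂

/-- Finite sums are monotone for the preorder `Θ ≤ Γ := Γ^⊥ ⊆ Θ^⊥`. -/
theorem msDual_sum_subset {X ι : Type*} {bot : Set (Multiset X)} (s : Finset ι)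
    {Γ Θ : ι → Multiset X} (h : ∀ i ∈ s, msDual bot (Γ i) ⊆ msDual bot (Θ i)) :
    msDual bot (∑ i ∈ s, Γ i) ⊆ msDual bot (∑ i ∈ s, Θ i) := by
  classical
  induction s using Finset.induction_on with
  | empty => simp
  | insert a s ha ih =>
    rw [Finset.sum_insert ha, Finset.sum_insert ha]
    exact msDual_add_subset (h a (Finset.mem_insert_self a s))
      (ih fun i hi => h i (Finset.mem_insert_of_mem hi))

/-- Conservativity of the unit of the free Girard quantale adjunction on unsigned
incompatibility frames: `{γ₁, …, γₙ} ∈ ⊥` iff every choice of multisets `Θᵢ ≤ {γᵢ}`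
(in the induced preorder `Θ ≤ Γ := Γ^⊥ ⊆ Θ^⊥`) has sum in `⊥`. -/
theorem conservativity_unsigned {X : Type*} (bot : Set (Multiset X))
    (n : ℕ) (γ : Fin n → X) :
    (∑ i : Fin n, ({γ i} : Multiset X)) ∈ bot ↔
      ∀ Θ : Fin n → Multiset X,
        (∀ i, msDual bot ({γ i} : Multiset X) ⊆ msDual bot (Θ i)) →
        (∑ i : Fin n, Θ i) ∈ bot := by
  refine ⟨fun h Θ hΘ => ?_, fun h => h _ fun _ => subset_rfl⟩
  have h₀ : (0 : Multiset X) ∈ msDual bot (∑ i, {γ i}) := by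
    simpa only [msDual, Set.mem_ofPred_eq, zero_add] using h
  simpa only [msDual, Set.mem_ofPred_eq, zero_add] using
    msDual_sum_subset Finset.univ (fun i _ => hΘ i) h₀
end

section
/- Let Q be a commutative quantale and let x : I → Q be a family of idempotent elements. Define s := the supremum, over all nonempty finite subsets J of I, of the products ⨂_{j ∈ J} x_j. Then: (i) s is idempotent; (ii) x_i ≤ s for every i ∈ I; (iii) for every idempotent element c with x_i ≤ c for all i ∈ I, one has s ≤ c. In particular, the idempotent elements of Q form a quantale with the same multiplication, in which the join of two idempotents x and y is x ⊔ y ⊔ (x ⊗ y). -/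
/-- A commutative quantale: a complete lattice with a commutative monoid operation
distributing over arbitrary suprema in each variable. -/
class CommQuantale (Q : Type*) extends CompleteLattice Q, CommMonoid Q where
  mul_sSup : ∀ (x : Q) (s : Set Q), x * sSup s = sSup ((fun y => x * y) '' s)

/-- The join, in the quantale of idempotents, of a family of idempotent elements:
the supremum over all nonempty finite subsets `J` of the index set of the products
`⨂_{j ∈ J} x_j`. -/
def idemSup {Q : Type*} [CommQuantale Q] {I : Type*} (x : I → Q) : Q :=
  ⨆ (J : Finset I) (_ : J.Nonempty), ∏ j ∈ J, x j

instance CommQuantale.isQuantale {Q : Type*} [CommQuantale Q] : IsQuantale Q where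
  mul_sSup_distrib x s := by rw [CommQuantale.mul_sSup, sSup_image]
  sSup_mul_distrib s y := by
    simp_rw [mul_comm _ y]
    rw [CommQuantale.mul_sSup, sSup_image]

theorem IsIdempotentElem.finset_prod {M I : Type*} [CommMonoid M] {x : I → M}
    (hx : ∀ i, IsIdempotentElem (x i)) (J : Finset I) :
    IsIdempotentElem (∏ j ∈ J, x j) := by
  unfold IsIdempotentElem
  rw [← Finset.prod_mul_distrib]
  exact Finset.prod_congr rfl fun j _ => hx j

theorem IsIdempotentElem.finset_prod_mul_finset_prod {M I : Type*} [CommMonoid M]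
    [DecidableEq I] {x : I → M} (hx : ∀ i, IsIdempotentElem (x i)) (J K : Finset I) :
    (∏ j ∈ J, x j) * ∏ j ∈ K, x j = ∏ j ∈ J ∪ K, x j := by
  rw [← Finset.prod_union_inter,
    ← Finset.prod_sdiff (Finset.inter_subset_left.trans Finset.subset_union_left :
      J ∩ K ⊆ J ∪ K), mul_assoc, (IsIdempotentElem.finset_prod hx (J ∩ K)).eq]

section CommQuantale

variable {Q : Type*} [CommQuantale Q] {I : Type*}

theorem idemSup_eq_iSup_subtype (x : I → Q) :
    idemSup x = ⨆ J : {J : Finset I // J.Nonempty}, ∏ j ∈ J.1, x j :=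
  iSup_subtype'

theorem finset_prod_le_idemSup (x : I → Q) {J : Finset I} (hJ : J.Nonempty) :
    ∏ j ∈ J, x j ≤ idemSup x :=
  le_iSup₂_of_le J hJ le_rfl

theorem le_idemSup (x : I → Q) (i : I) : x i ≤ idemSup x := by
  simpa using finset_prod_le_idemSup x (Finset.singleton_nonempty i)

theorem isIdempotentElem_idemSup {x : I → Q} (hx : ∀ i, IsIdempotentElem (x i)) :
    IsIdempotentElem (idemSup x) := by
  classical
  apply le_antisymm
  · conv_lhs => rw [idemSup_eq_iSup_subtype]
    simp_rw [Quantale.iSup_mul_distrib, Quantale.mul_iSup_distrib]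
    refine iSup_le fun J => iSup_le fun _ => ?_
    rw [IsIdempotentElem.finset_prod_mul_finset_prod hx]
    exact finset_prod_le_idemSup x (J.2.mono Finset.subset_union_left)
  · refine iSup₂_le fun J hJ => ?_
    rw [← (IsIdempotentElem.finset_prod hx J).eq]
    exact mul_le_mul' (finset_prod_le_idemSup x hJ) (finset_prod_le_idemSup x hJ)

theorem idemSup_le {x : I → Q} {c : Q} (hc : IsIdempotentElem c) (h : ∀ i, x i ≤ c) :
    idemSup x ≤ c := by
  refine iSup₂_le fun J hJ => ?_
  induction hJ using Finset.Nonempty.cons_induction with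
  | singleton i => simpa using h i
  | cons i J hi _ ih =>
    rw [Finset.prod_cons]
    exact (mul_le_mul' (h i) ih).trans_eq hc.eq

theorem IsIdempotentElem.sup_sup_mul {a b : Q} (ha : IsIdempotentElem a)
    (hb : IsIdempotentElem b) : IsIdempotentElem (a ⊔ b ⊔ a * b) := by
  have h₁ : a * (a * b) = a * b := by rw [← mul_assoc, ha.eq]
  have h₂ : b * (a * b) = a * b := by rw [mul_left_comm, hb.eq]
  unfold IsIdempotentElem
  simp only [Quantale.mul_sup_distrib, Quantale.sup_mul_distrib, mul_assoc, ha.eq, hb.eq, h₁, h₂,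
    mul_comm b a]
  apply le_antisymm <;> simp [le_sup_of_le_left, le_sup_of_le_right]

end CommQuantale

/-- The idempotent elements of a commutative quantale form a quantale with the same
multiplication: the supremum `s` of products over nonempty finite subsets of a family
of idempotents is (i) idempotent, (ii) an upper bound, and (iii) least among
idempotent upper bounds; in particular the join of two idempotents `x`, `y` is
`x ⊔ y ⊔ (x ⊗ y)`. -/
theorem idempotent_subquantale {Q : Type*} [CommQuantale Q] {I : Type*}
    (x : I → Q) (hx : ∀ i, x i * x i = x i) :
    (idemSup x * idemSup x = idemSup x) ∧
    (∀ i, x i ≤ idemSup x) ∧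
    (∀ c : Q, c * c = c → (∀ i, x i ≤ c) → idemSup x ≤ c) ∧
    (∀ a b : Q, a * a = a → b * b = b →
      ((a ⊔ b ⊔ a * b) * (a ⊔ b ⊔ a * b) = a ⊔ b ⊔ a * b) ∧
      a ≤ a ⊔ b ⊔ a * b ∧ b ≤ a ⊔ b ⊔ a * b ∧
      (∀ c : Q, c * c = c → a ≤ c → b ≤ c → a ⊔ b ⊔ a * b ≤ c)) := by
  refine ⟨isIdempotentElem_idemSup hx, le_idemSup x, fun c hc h => idemSup_le hc h,
    fun a b ha hb => ⟨IsIdempotentElem.sup_sup_mul ha hb, le_sup_left.trans le_sup_left,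
      le_sup_right.trans le_sup_left, fun c hc hac hbc => ?_⟩⟩
  exact sup_le (sup_le hac hbc) ((mul_le_mul' hac hbc).trans_eq hc)
end

section
/- Let Q be a Girard quantale with least element 0, and let a₊, a₋, b₊, b₋ be idempotent elements of Q (x ⊗ x = x) satisfying the containment conditions a₊ ⊗ a₋ = 0 and b₊ ⊗ b₋ = 0. Then: (i) (a₊ ⊔ b₊ ⊔ (a₊ ⊗ b₊)) ⊗ (a₊ ⊔ b₋ ⊔ (a₊ ⊗ b₋)) = a₊ ⊗ (1 ⊔ b₊ ⊔ b₋); (ii) (a₋ ⊗ b₋) ⊔ (a₋ ⊗ b₊) ⊔ (a₋ ⊗ b₊ ⊗ b₋) = a₋ ⊗ (b₋ ⊔ b₊); (iii) (a₊ ⊗ (1 ⊔ b₊ ⊔ b₋)) ⊗ a₋ ≤ ⊥ and a₊ ⊗ (a₋ ⊗ (b₋ ⊔ b₊)) ≤ ⊥. (These computations show that the semantic values validate the Robbins-style law (A ∨ B) ∧ (A ∨ ¬B) = A, making the Lindenbaum algebra of the contractive implication space semantics a Boolean algebra and the semantic consequence relation supraclassical.) -/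
/-- A Girard quantale: a complete lattice with a commutative monoid operation
distributing over arbitrary suprema, together with a dualizing element `dd`. -/
class GirardQuantale (Q : Type*) extends CompleteLattice Q, CommMonoid Q where
  mul_sSup : ∀ (x : Q) (s : Set Q), x * sSup s = sSup ((fun y => x * y) '' s)
  dd : Q
  dual_dual : ∀ x : Q, sSup {z | z * sSup {z' | z' * x ≤ dd} ≤ dd} = x

namespace GirardQuantale

variable {Q : Type*} [GirardQuantale Q]

theorem mul_sup (x y z : Q) : x * (y ⊔ z) = x * y ⊔ x * z := by
  rw [← sSup_pair, mul_sSup, Set.image_pair, sSup_pair]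

theorem sup_mul (x y z : Q) : (x ⊔ y) * z = x * z ⊔ y * z := by
  rw [mul_comm, mul_sup, mul_comm z x, mul_comm z y]

theorem mul_bot (x : Q) : x * (⊥ : Q) = ⊥ := by
  rw [← sSup_empty, mul_sSup, Set.image_empty]

theorem bot_mul (x : Q) : (⊥ : Q) * x = ⊥ := by
  rw [mul_comm, mul_bot]

end GirardQuantale

/-- The Robbins-style computation validating `(A ∨ B) ∧ (A ∨ ¬B) = A` in the
contractive implication space semantics: for idempotent, containment-satisfying
pairs of elements of a Girard quantale. -/
theorem robbins_computation {Q : Type*} [GirardQuantale Q]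
    (ap am bp bm : Q)
    (hap : ap * ap = ap) (ham : am * am = am)
    (hbp : bp * bp = bp) (hbm : bm * bm = bm)
    (ha : ap * am = (⊥ : Q)) (hb : bp * bm = (⊥ : Q)) :
    ((ap ⊔ bp ⊔ ap * bp) * (ap ⊔ bm ⊔ ap * bm) = ap * (1 ⊔ bp ⊔ bm)) ∧
    ((am * bm) ⊔ (am * bp) ⊔ (am * bp * bm) = am * (bm ⊔ bp)) ∧
    ((ap * (1 ⊔ bp ⊔ bm)) * am ≤ (GirardQuantale.dd : Q)) ∧
    (ap * (am * (bm ⊔ bp)) ≤ (GirardQuantale.dd : Q)) := by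
  have hbot : ap * (am * (bm ⊔ bp)) = ⊥ := by
    rw [← mul_assoc, ha, GirardQuantale.bot_mul]
  refine ⟨?_, ?_, ?_, hbot.trans_le bot_le⟩
  · have h₁ : ap * (ap * bm) = ap * bm := by rw [← mul_assoc, hap]
    have h₂ : bp * (ap * bm) = ⊥ := by
      rw [mul_left_comm, hb, GirardQuantale.mul_bot]
    have h₃ : ap * bp * ap = ap * bp := by rw [mul_right_comm, hap]
    have h₄ : ap * bp * bm = ⊥ := by rw [mul_assoc, hb, GirardQuantale.mul_bot]
    have h₅ : ap * bp * (ap * bm) = ⊥ := by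
      rw [mul_mul_mul_comm, hb, GirardQuantale.mul_bot]
    simp only [GirardQuantale.mul_sup, GirardQuantale.sup_mul, hap, hb, h₁, h₂, h₃, h₄, h₅,
      mul_comm bp ap, mul_one, sup_bot_eq]
    apply le_antisymm <;> simp [sup_comm, sup_left_comm]
  · rw [mul_assoc am bp bm, hb, GirardQuantale.mul_bot, sup_bot_eq, GirardQuantale.mul_sup]
  · rw [mul_right_comm, ha, GirardQuantale.bot_mul]
    exact bot_le
end

section
/- Let X be a type and ⊥ a set of positions, where a position is a pair (Γ, Δ) of multisets over X, added componentwise. For a set S of positions define S^⊥ := {(Θ, Ω) | ∀ (Γ, Δ) ∈ S, (Γ + Θ, Δ + Ω) ∈ ⊥}. Suppose the frame satisfies reflexivity: ({x}, {x}) ∈ ⊥ for every x ∈ X. For elements a of the frame define the interpretation ⟦a⟧ := ⟨({a}, ∅)^{⊥⊥}, (∅, {a})^{⊥⊥}⟩ (where for a single position p, p^⊥ := {p}^⊥). Then the interpretation of every atom is reflexive in the semantic sense: the product set {(Γ + Γ', Δ + Δ') | (Γ, Δ) ∈ ({a},∅)^{⊥⊥}, (Γ', Δ') ∈ (∅,{a})^{⊥⊥}}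 is contained in ⊥; equivalently ({a},∅)^{⊥⊥} ⊆ ((∅,{a})^{⊥⊥})^⊥. (In a reflexive implication frame, every atomic semantic value ⟦a⟧ validates the identity sequent ⟦a⟧ ⊨ ⟦a⟧.) -/
/-- The range of subjunctive robustness (dual) of a set of positions:
`S^⊥ = {(Θ, Ω) | ∀ (Γ, Δ) ∈ S, (Γ + Θ, Δ + Ω) ∈ bot}`. -/
def rsr {X : Type*} (bot : Set (Multiset X × Multiset X))
    (S : Set (Multiset X × Multiset X)) : Set (Multiset X × Multiset X) :=
  {p | ∀ q ∈ S, (q.1 + p.1, q.2 + p.2) ∈ bot}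

/-- If the sum of `p` and `q` is in `bot`, then any member of `p^⊥⊥` and any member of
`q^⊥⊥` sum to a member of `bot`. -/
theorem add_mem_of_mem_rsr_rsr_singleton {X : Type*}
    {bot : Set (Multiset X × Multiset X)} {p q g g' : Multiset X × Multiset X}
    (hpq : (p.1 + q.1, p.2 + q.2) ∈ bot)
    (hg : g ∈ rsr bot (rsr bot {p})) (hg' : g' ∈ rsr bot (rsr bot {q})) :
    (g.1 + g'.1, g.2 + g'.2) ∈ bot := by
  refine hg' g ?_
  rintro _ rfl
  refine hg _ ?_
  rintro _ rfl
  exact hpq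

/-- In a reflexive implication frame, every atomic semantic value
`⟦a⟧ = ⟨({a},∅)^{⊥⊥}, (∅,{a})^{⊥⊥}⟩` validates the identity sequent `⟦a⟧ ⊨ ⟦a⟧`:
the set of componentwise sums of its premisory and conclusory roles is contained in
`⊥`; equivalently `({a},∅)^{⊥⊥} ⊆ ((∅,{a})^{⊥⊥})^⊥`. -/
theorem atomic_interpretation_reflexive {X : Type*}
    (bot : Set (Multiset X × Multiset X))
    (hrefl : ∀ x : X, (({x} : Multiset X), ({x} : Multiset X)) ∈ bot) (a : X) :
    ({r : Multiset X × Multiset X |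
        ∃ g ∈ rsr bot (rsr bot {(({a} : Multiset X), (0 : Multiset X))}),
          ∃ g' ∈ rsr bot (rsr bot {((0 : Multiset X), ({a} : Multiset X))}),
            r = (g.1 + g'.1, g.2 + g'.2)} ⊆ bot) ∧
    (rsr bot (rsr bot {(({a} : Multiset X), (0 : Multiset X))}) ⊆
      rsr bot (rsr bot (rsr bot {((0 : Multiset X), ({a} : Multiset X))}))) := by
  have hpq : (({a} : Multiset X) + 0, (0 : Multiset X) + {a}) ∈ bot := by
    simpa using hrefl a
  constructor
  · rintro _ ⟨g, hg, g', hg', rfl⟩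
    exact add_mem_of_mem_rsr_rsr_singleton hpq hg hg'
  · intro g hg g' hg'
    rw [add_comm g'.1, add_comm g'.2]
    exact add_mem_of_mem_rsr_rsr_singleton hpq hg hg'
end
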